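/- arXiv:2403.03802 — 2 statements merged into one kernel-verified Lean document; each statement's English description precedes it below -/
import Mathlib

section
/- Let X be a random variable with CDF F, and let 1 ≤ j ≤ m and 1 ≤ i ≤ n with i ≥ j. If F is IOR (i.e. the odds function x ↦ F(x)/(1−F(x)) is convex on {x : F(x) < 1}) and i/n ≥ j/m, then X_{i:n} ≥_icv X_{j:m}. -/
open MeasureTheory Set Filter

/-- Generalized inverse (quantile function) `F⁻¹(p) = inf {x | p ≤ F x}` of a CDF `F`. -/
noncomputable def qf (F : ℝ → ℝ) (p : ℝ) : ℝ := sInf {x | p ≤ F x}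

/-- `F` is a cumulative distribution function: monotone, right-continuous, with limits
`0` at `-∞` and `1` at `+∞`. -/
def IsCDF (F : ℝ → ℝ) : Prop :=
  Monotone F ∧ (∀ x, ContinuousWithinAt F (Set.Ici x) x) ∧
    Tendsto F atBot (nhds 0) ∧ Tendsto F atTop (nhds 1)

/-- The (real) Beta function `B(a,b) = ∫₀¹ t^(a-1) (1-t)^(b-1) dt`. -/
noncomputable def Bfun (a b : ℝ) : ℝ :=
  ∫ t in Set.Ioo (0:ℝ) 1, t ^ (a - 1) * (1 - t) ^ (b - 1)

/-- The Beta(i, n-i+1) distribution on `ℝ`, i.e. the law of the `i`-th order statistic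
`B_{i:n}` of an i.i.d. uniform sample of size `n`. -/
noncomputable def betaLaw (i n : ℕ) : Measure ℝ :=
  (volume.restrict (Set.Ioo (0:ℝ) 1)).withDensity fun t =>
    ENNReal.ofReal (t ^ ((i:ℝ) - 1) * (1 - t) ^ ((n:ℝ) - (i:ℝ)) / Bfun (i:ℝ) ((n:ℝ) - (i:ℝ) + 1))

/-- The law of the `i`-th order statistic `X_{i:n}` of an i.i.d. sample of size `n` from the
CDF `F`: the pushforward of the Beta(i, n-i+1) measure under the quantile function `F⁻¹`. -/
noncomputable def osLaw (F : ℝ → ℝ) (i n : ℕ) : Measure ℝ := (betaLaw i n).map (qf F)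

/-- The `k`-th harmonic number `H_k = ∑_{r=1}^k 1/r`. -/
noncomputable def harm (k : ℕ) : ℝ := ∑ r ∈ Finset.Icc 1 k, (1:ℝ) / r

/-- Increasing concave order: `icvLE μ ν` means a random variable with law `μ` dominates one
with law `ν` in the increasing concave order, i.e. `E u(X) ≥ E u(Y)` for every increasing
concave `u` for which both expectations exist. -/
def icvLE (μ ν : MeasureTheory.Measure ℝ) : Prop :=
  ∀ u : ℝ → ℝ, Monotone u → ConcaveOn ℝ Set.univ u →
    MeasureTheory.Integrable u μ → MeasureTheory.Integrable u ν →
      ∫ x, u x ∂ν ≤ ∫ x, u x ∂μ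

/-- Increasing convex order: `icxLE μ ν` means a random variable with law `μ` dominates one
with law `ν` in the increasing convex order, i.e. `E u(X) ≥ E u(Y)` for every increasing
convex `u` for which both expectations exist. -/
def icxLE (μ ν : MeasureTheory.Measure ℝ) : Prop :=
  ∀ u : ℝ → ℝ, Monotone u → ConvexOn ℝ Set.univ u →
    MeasureTheory.Integrable u μ → MeasureTheory.Integrable u ν →
      ∫ x, u x ∂ν ≤ ∫ x, u x ∂μ

/-- A star-shaped function on `[0,∞)`: nonnegative there, vanishing at `0`, with
`x ↦ φ x / x` increasing on `(0,∞)`. -/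
def StarShaped (φ : ℝ → ℝ) : Prop :=
  φ 0 = 0 ∧ (∀ x, 0 ≤ x → 0 ≤ φ x) ∧ MonotoneOn (fun x => φ x / x) (Set.Ioi 0)

/-- Star-shaped order: `ssLE μ ν` means a (nonnegative) random variable with law `μ`
dominates one with law `ν` in the star-shaped order, i.e. `E φ(X) ≥ E φ(Y)` for every
star-shaped `φ` for which both expectations exist. -/
def ssLE (μ ν : MeasureTheory.Measure ℝ) : Prop :=
  ∀ φ : ℝ → ℝ, StarShaped φ → MeasureTheory.Integrable φ μ → MeasureTheory.Integrable φ ν →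
    ∫ x, φ x ∂ν ≤ ∫ x, φ x ∂μ


noncomputable def Wt (a b : ℕ) (t : ℝ) : ℝ := t ^ a * (1 - t) ^ b
noncomputable def It (a b : ℕ) : ℝ := ∫ t in Ioo (0:ℝ) 1, Wt a b t

lemma Wt_cont (a b : ℕ) : Continuous (Wt a b) := by unfold Wt; fun_prop

lemma Wt_int (a b : ℕ) : IntegrableOn (Wt a b) (Ioo (0:ℝ) 1) :=
  ((Wt_cont a b).integrableOn_Icc).mono_set Ioo_subset_Icc_self

lemma Wt_pos (a b : ℕ) {t : ℝ} (ht : t ∈ Ioo (0:ℝ) 1) : 0 < Wt a b t := by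
  have h1 := ht.1
  have h2 : 0 < 1 - t := by linarith [ht.2]
  unfold Wt; positivity

lemma ioo_interval (f : ℝ → ℝ) : ∫ t in Ioo (0:ℝ) 1, f t = ∫ t in (0:ℝ)..1, f t := by
  rw [intervalIntegral.integral_of_le zero_le_one, integral_Ioc_eq_integral_Ioo]

lemma It_pos (a b : ℕ) : 0 < It a b := by
  unfold It
  rw [ioo_interval]
  refine intervalIntegral.intervalIntegral_pos_of_pos_on
    ((Wt_cont a b).intervalIntegrable _ _) (fun t ht => Wt_pos a b ht) zero_lt_one

lemma It_rec (a b : ℕ) : ((a:ℝ) + 1) * It a (b+1) = ((b:ℝ) + 1) * It (a+1) b := by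
  have h : ∫ t in (0:ℝ)..1, (((a:ℝ)+1) * Wt a (b+1) t - ((b:ℝ)+1) * Wt (a+1) b t) =
      Wt (a+1) (b+1) 1 - Wt (a+1) (b+1) 0 := by
    apply intervalIntegral.integral_eq_sub_of_hasDerivAt
    · intro x _
      have h1 := (hasDerivAt_id x).pow (a+1)
      have h2 := ((hasDerivAt_id x).const_sub 1).pow (b+1)
      have h3 := h1.mul h2
      refine h3.congr_deriv ?_
      simp [Wt]; ring
    · apply Continuous.intervalIntegrable
      have := Wt_cont a (b+1); have := Wt_cont (a+1) b; fun_prop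
  rw [intervalIntegral.integral_sub, intervalIntegral.integral_const_mul,
    intervalIntegral.integral_const_mul] at h
  · simp only [It, ioo_interval]
    simp [Wt] at h ⊢
    linarith
  · exact ((Wt_cont a (b+1)).const_smul ((a:ℝ)+1)).intervalIntegrable _ _
  · exact ((Wt_cont (a+1) b).const_smul ((b:ℝ)+1)).intervalIntegrable _ _

/-- chord property -/
lemma chord (h : ℝ → ℝ) (hm : MonotoneOn h (Ioo 0 1))
    (hc : ConcaveOn ℝ (Ioi 0) (fun z => h (z / (1 + z)))) {p q : ℝ}
    (hp : p ∈ Ioo (0:ℝ) 1) (hq : q ∈ Ioo (0:ℝ) 1) (hpq : p < q) :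
    ∃ α β : ℝ, 0 ≤ β ∧ (∀ t ∈ Ioo (0:ℝ) 1, t ∈ Icc p q → α + β * (t / (1 - t)) ≤ h t) ∧
      (∀ t ∈ Ioo (0:ℝ) 1, t ∉ Icc p q → h t ≤ α + β * (t / (1 - t))) := by
  have od : ∀ t ∈ Ioo (0:ℝ) 1, 0 < t / (1 - t) := fun t ht =>
    div_pos ht.1 (by linarith [ht.2])
  have ov : ∀ t ∈ Ioo (0:ℝ) 1, h ((t / (1 - t)) / (1 + t / (1 - t))) = h t := by
    intro t ht
    have : 1 - t ≠ 0 := by linarith [ht.2]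
    congr 1; field_simp; simp
  have om : ∀ s ∈ Ioo (0:ℝ) 1, ∀ t ∈ Ioo (0:ℝ) 1, s < t → s / (1 - s) < t / (1 - t) := by
    intro s hs t ht hst
    rw [div_lt_div_iff₀ (by linarith [hs.2]) (by linarith [ht.2])]
    nlinarith
  have key : ∀ r ∈ Ioo (0:ℝ) 1, ∀ s ∈ Ioo (0:ℝ) 1, ∀ t ∈ Ioo (0:ℝ) 1, r < s → s < t →
      (h t - h s) * (s / (1 - s) - r / (1 - r)) ≤ (h s - h r) * (t / (1 - t) - s / (1 - s)) := by
    intro r hr s hs t ht hrs hst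
    have a1 := om r hr s hs hrs
    have a2 := om s hs t ht hst
    have := hc.slope_anti_adjacent (od r hr) (od t ht) a1 a2
    simp only [ov r hr, ov s hs, ov t ht] at this
    rwa [div_le_div_iff₀ (by linarith) (by linarith)] at this
  have d := om p hp q hq hpq
  set P := p / (1 - p) with hP
  set Q := q / (1 - q) with hQ
  have dpos : 0 < Q - P := by linarith
  obtain ⟨β, hβ⟩ : ∃ β, β = (h q - h p) / (Q - P) := ⟨_, rfl⟩
  have e1 : h q = h p + β * (Q - P) := by rw [hβ]; field_simp; ring
  have hmon := hm hp hq hpq.le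
  refine ⟨h p - β * P, β, ?_, ?_, ?_⟩
  · rw [hβ]; exact div_nonneg (by linarith) dpos.le
  · intro t ht htt
    rcases eq_or_lt_of_le htt.1 with rfl | h1
    · linarith
    rcases eq_or_lt_of_le htt.2 with rfl | h2
    · linarith
    have := key p hp t ht q hq h1 h2
    have b1 := om p hp t ht h1
    have b2 := om t ht q hq h2
    simp only [← hP, ← hQ] at *
    set T := t / (1 - t)
    by_contra hcon
    push Not at hcon
    rw [e1] at this
    nlinarith [mul_pos dpos (sub_pos.2 hcon)]
  · intro t ht htt
    rcases lt_or_ge t p with h1 | h1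
    · have := key t ht p hp q hq h1 hpq
      simp only [← hP, ← hQ] at *
      set T := t / (1 - t)
      rw [e1] at this
      by_contra hcon
      push Not at hcon
      nlinarith [mul_pos dpos (sub_pos.2 hcon)]
    · have h2 : q < t := by
        by_contra h2
        exact htt ⟨h1, not_lt.1 h2⟩
      have := key p hp q hq t ht hpq h2
      simp only [← hP, ← hQ] at *
      set T := t / (1 - t)
      by_contra hcon
      push Not at hcon
      have e2 : h t - h q > β * (T - Q) := by rw [e1]; linarith
      have e3 : h q - h p = β * (Q - P) := by linarith
      rw [e3] at this
      nlinarith [mul_pos dpos (sub_pos.2 e2)]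

lemma concave_qf (F : ℝ → ℝ) (hF : Monotone F) (h0 : Tendsto F atBot (nhds 0))
    (h1 : Tendsto F atTop (nhds 1))
    (hI : ConvexOn ℝ {x : ℝ | F x < 1} (fun x => F x / (1 - F x))) :
    MonotoneOn (fun p => sInf {x | p ≤ F x}) (Ioo 0 1) ∧
    ConcaveOn ℝ (Ioi 0) (fun z : ℝ => sInf {x | z / (1 + z) ≤ F x}) := by
  have ne : ∀ p ∈ Ioo (0:ℝ) 1, {x | p ≤ F x}.Nonempty := by
    intro p hp
    obtain ⟨x, hx⟩ := (h1.eventually (lt_mem_nhds hp.2)).exists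
    exact ⟨x, le_of_lt hx⟩
  have bdd : ∀ p ∈ Ioo (0:ℝ) 1, BddBelow {x | p ≤ F x} := by
    intro p hp
    obtain ⟨x, hx⟩ := (h0.eventually (gt_mem_nhds hp.1)).exists
    refine ⟨x, fun y hy => ?_⟩
    by_contra hc
    have := hF (not_le.1 hc).le
    have hy' : p ≤ F y := hy
    linarith
  constructor
  · intro p hp q hq hpq
    exact csInf_le_csInf (bdd p hp) (ne q hq) (fun x hx => le_trans hpq hx)
  · have o : ∀ z : ℝ, 0 < z → z / (1 + z) ∈ Ioo (0:ℝ) 1 := fun z hz =>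
      ⟨by positivity, by rw [div_lt_one (by positivity)]; linarith⟩
    refine ⟨convex_Ioi 0, ?_⟩
    intro z1 hz1 z2 hz2 s t hs ht hst
    have hz1 : 0 < z1 := hz1
    have hz2 : 0 < z2 := hz2
    have hz : 0 < s * z1 + t * z2 := by
      rcases hs.eq_or_lt with rfl | hs'
      · have : t = 1 := by linarith
        subst this; simpa using hz2
      · positivity
    simp only [smul_eq_mul]
    set x1 := sInf {x | z1 / (1 + z1) ≤ F x} with hx1
    set x2 := sInf {x | z2 / (1 + z2) ≤ F x} with hx2
    apply le_of_forall_pos_le_add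
    intro ε hε
    have A : ∀ z : ℝ, 0 < z → F (sInf {x | z / (1 + z) ≤ F x} - ε) < z / (1 + z) := by
      intro z hz
      by_contra hc
      have := csInf_le (bdd _ (o z hz)) (not_lt.1 hc)
      linarith
    have odd : ∀ z : ℝ, 0 < z → ∀ y, F y < z / (1 + z) → F y < 1 ∧ F y / (1 - F y) < z := by
      intro z hz y hy
      have := (o z hz).2
      refine ⟨by linarith, ?_⟩
      rw [div_lt_iff₀ (by linarith)]
      rw [lt_div_iff₀ (by positivity)] at hy
      nlinarith
    obtain ⟨a1, b1⟩ := odd z1 hz1 _ (A z1 hz1)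
    obtain ⟨a2, b2⟩ := odd z2 hz2 _ (A z2 hz2)
    have c1 := hI.1 a1 a2 hs ht hst
    have c2 := hI.2 a1 a2 hs ht hst
    simp only [smul_eq_mul] at c1 c2
    have c1 : F (s * (x1 - ε) + t * (x2 - ε)) < 1 := c1
    have c3 : F (s * (x1 - ε) + t * (x2 - ε)) / (1 - F (s * (x1 - ε) + t * (x2 - ε)))
        < s * z1 + t * z2 := by
      refine c2.trans_lt ?_
      rcases hs.eq_or_lt with rfl | hs'
      · have : t = 1 := by linarith
        subst this; simpa using b2
      · exact add_lt_add_of_lt_of_le (mul_lt_mul_of_pos_left b1 hs')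
          (mul_le_mul_of_nonneg_left b2.le ht)
    have c4 : F (s * (x1 - ε) + t * (x2 - ε)) < (s * z1 + t * z2) / (1 + (s * z1 + t * z2)) := by
      rw [div_lt_iff₀ (by linarith)] at c3
      rw [lt_div_iff₀ (by linarith)]
      linarith
    have c5 : s * (x1 - ε) + t * (x2 - ε) ≤
        sInf {x | (s * z1 + t * z2) / (1 + (s * z1 + t * z2)) ≤ F x} := by
      apply le_csInf (ne _ (o _ hz))
      intro y hy
      by_contra hc
      have := hF (not_le.1 hc).le
      have hy' : _ ≤ F y := hy
      linarith
    have : s * ε + t * ε = ε := by rw [← add_mul, hst, one_mul]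
    linarith

lemma zero_pt (D : ℝ → ℝ) (hD : Continuous D) (h0 : ∫ t in Ioo (0:ℝ) 1, D t = 0) :
    ∃ p ∈ Ioo (0:ℝ) 1, D p = 0 := by
  obtain ⟨c, hc, h⟩ := exists_eq_interval_average (f := D) (a := 0) (b := 1) (by norm_num)
    hD.continuousOn
  rw [uIoo_of_le zero_le_one] at hc
  refine ⟨c, hc, ?_⟩
  rw [h, interval_average_eq, ← ioo_interval, h0]; simp

/-- sign structure -/
lemma signs (h : ℝ → ℝ) (hm : MonotoneOn h (Ioo 0 1))
    (hc : ConcaveOn ℝ (Ioi 0) (fun z => h (z / (1 + z))))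
    (a b c d : ℕ) (hac : c ≤ a) (hcond : (c + 1) * b ≤ (a + 1) * d)
    (D : ℝ → ℝ) (hD : D = fun t => Wt a b t / It a b - Wt c d t / It c d)
    (h0 : ∫ t in Ioo (0:ℝ) 1, D t = 0) :
    (∃ κ : ℝ, ∀ t ∈ Ioo (0:ℝ) 1, 0 ≤ (h t - κ) * D t) ∨
    (∀ t ∈ Ioo (0:ℝ) 1, D t ≤ 0) ∨
    (0 < b ∧ 0 < d ∧ ∃ α β : ℝ, 0 ≤ β ∧ ∀ t ∈ Ioo (0:ℝ) 1,
      0 ≤ (h t - (α + β * (t / (1 - t)))) * D t) := by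
  have hDc : Continuous D := by
    rw [hD]
    exact ((Wt_cont a b).div_const _).sub ((Wt_cont c d).div_const _)
  obtain ⟨p0, hp0, hz⟩ := zero_pt D hDc h0
  have B1 := It_pos a b
  have B2 := It_pos c d
  obtain ⟨e, rfl⟩ := Nat.exists_eq_add_of_le hac
  set I1 := It (c + e) b
  set I2 := It c d
  rcases le_total b d with hbd | hbd
  · left
    obtain ⟨f, rfl⟩ := Nat.exists_eq_add_of_le hbd
    refine ⟨h p0, ?_⟩
    have fac : ∀ t, D t = Wt c b t * (t ^ e / I1 - (1 - t) ^ f / I2) := by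
      intro t; rw [hD]; simp only [Wt]; ring
    have hz' : p0 ^ e / I1 - (1 - p0) ^ f / I2 = 0 := by
      rw [fac] at hz
      rcases mul_eq_zero.1 hz with h | h
      · exact absurd h (Wt_pos c b hp0).ne'
      · exact h
    intro t ht
    have w := Wt_pos c b ht
    have t1 : 0 < 1 - t := by linarith [ht.2]
    have t2 : 0 < 1 - p0 := by linarith [hp0.2]
    rw [fac]
    rcases le_total t p0 with h1 | h1
    · have m := hm ht hp0 h1
      have : t ^ e / I1 ≤ p0 ^ e / I1 := by
        have := ht.1
        gcongr
      have : (1 - p0) ^ f / I2 ≤ (1 - t) ^ f / I2 := by gcongr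
      exact mul_nonneg_of_nonpos_of_nonpos (by linarith)
        (mul_nonpos_of_nonneg_of_nonpos w.le (by linarith))
    · have m := hm hp0 ht h1
      have : p0 ^ e / I1 ≤ t ^ e / I1 := by
        have := hp0.1
        gcongr
      have : (1 - t) ^ f / I2 ≤ (1 - p0) ^ f / I2 := by gcongr
      exact mul_nonneg (by linarith) (mul_nonneg w.le (by linarith))
  rcases eq_or_lt_of_le hbd with hbd' | hbd'
  · have hdb := hbd'
    left
    subst hbd'
    refine ⟨h p0, ?_⟩
    have fac : ∀ t, D t = Wt c d t * (t ^ e / I1 - 1 / I2) := by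
      intro t; rw [hD]; simp only [Wt]; ring
    have hz' : p0 ^ e / I1 - 1 / I2 = 0 := by
      rw [fac] at hz
      rcases mul_eq_zero.1 hz with h | h
      · exact absurd h (Wt_pos c d hp0).ne'
      · exact h
    intro t ht
    have w := Wt_pos c d ht
    rw [fac]
    rcases le_total t p0 with h1 | h1
    · have m := hm ht hp0 h1
      have : t ^ e / I1 ≤ p0 ^ e / I1 := by
        have := ht.1
        gcongr
      exact mul_nonneg_of_nonpos_of_nonpos (by linarith)
        (mul_nonpos_of_nonneg_of_nonpos w.le (by linarith))
    · have m := hm hp0 ht h1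
      have : p0 ^ e / I1 ≤ t ^ e / I1 := by
        have := hp0.1
        gcongr
      exact mul_nonneg (by linarith) (mul_nonneg w.le (by linarith))
  right
  obtain ⟨f, rfl⟩ := Nat.exists_eq_add_of_le hbd
  have hf : 0 < f := by omega
  have he : e ≠ 0 := by
    rintro rfl
    have : 0 < (c + 1) * f := by positivity
    simp only [add_zero] at hcond
    nlinarith
  have hd : 0 < d := by
    rcases Nat.eq_zero_or_pos d with rfl | h
    · have : 0 < (c + 1) * f := by positivity
      simp at hcond
      omega
    · exact h
  have fac : ∀ t, D t = Wt c d t * (Wt e f t / I1 - 1 / I2) := by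
    intro t; rw [hD]; simp only [Wt]; ring
  let S : Set ℝ := Icc 0 1 ∩ {t | I1 / I2 ≤ Wt e f t}
  have hS : IsCompact S :=
    isCompact_Icc.inter_right (isClosed_le continuous_const (Wt_cont e f))
  have hr : 0 < I1 / I2 := div_pos B1 B2
  have hSo : S ⊆ Ioo 0 1 := by
    rintro t ⟨⟨h1, h2⟩, h3⟩
    have h3 : I1 / I2 ≤ Wt e f t := h3
    refine ⟨lt_of_le_of_ne h1 ?_, lt_of_le_of_ne h2 ?_⟩
    · rintro rfl
      simp [Wt, he] at h3; linarith
    · rintro rfl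
      simp [Wt, hf.ne'] at h3; linarith
  have sgn : ∀ t, (I1 / I2 ≤ Wt e f t ↔ 0 ≤ Wt e f t / I1 - 1 / I2) := by
    intro t
    rw [sub_nonneg, div_le_div_iff₀ B2 B1, div_le_iff₀ B2, one_mul]
  have hin : ∀ t ∈ Ioo (0:ℝ) 1, t ∈ S → 0 ≤ D t := by
    intro t ht hts
    rw [fac]
    exact mul_nonneg (Wt_pos c d ht).le ((sgn t).1 hts.2)
  have hout : ∀ t ∈ Ioo (0:ℝ) 1, t ∉ S → D t < 0 := by
    intro t ht hts
    rw [fac]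
    refine mul_neg_of_pos_of_neg (Wt_pos c d ht) ?_
    by_contra hcon
    exact hts ⟨⟨ht.1.le, ht.2.le⟩, (sgn t).2 (not_lt.1 hcon)⟩
  have hp0S : p0 ∈ S := by
    by_contra hcon
    exact absurd hz (hout p0 hp0 hcon).ne
  have hconv : Convex ℝ S := by
    have hl : ConcaveOn ℝ (Ioo (0:ℝ) 1)
        (fun t => (e:ℝ) * Real.log t + (f:ℝ) * Real.log (1 - t)) := by
      have l1 : ConcaveOn ℝ (Ioo (0:ℝ) 1) Real.log :=
        strictConcaveOn_log_Ioi.concaveOn.subset (fun x hx => hx.1) (convex_Ioo 0 1)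
      have l2 : ConcaveOn ℝ (Ioo (0:ℝ) 1) (fun t => Real.log (1 - t)) := by
        refine ⟨convex_Ioo 0 1, ?_⟩
        intro x hx y hy s t hs ht hst
        have := strictConcaveOn_log_Ioi.concaveOn.2 (x := 1 - x) (y := 1 - y)
          (by simpa using hx.2) (by simpa using hy.2) hs ht hst
        simp only [smul_eq_mul] at this ⊢
        convert this using 2
        linear_combination (-1) * hst
      exact (l1.smul (Nat.cast_nonneg e)).add (l2.smul (Nat.cast_nonneg f))
    have := hl.convex_ge (Real.log (I1 / I2))
    convert this using 1
    ext t
    have lg : t ∈ Ioo (0:ℝ) 1 → (I1 / I2 ≤ Wt e f t ↔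
        Real.log (I1 / I2) ≤ (e:ℝ) * Real.log t + (f:ℝ) * Real.log (1 - t)) := by
      intro ht
      have t1 : 0 < 1 - t := by linarith [ht.2]
      have t0 := ht.1
      rw [← Real.log_le_log_iff hr (Wt_pos e f ht)]
      unfold Wt
      rw [Real.log_mul (by positivity) (by positivity), Real.log_pow, Real.log_pow]
    constructor
    · intro h
      exact ⟨hSo h, (lg (hSo h)).1 h.2⟩
    · rintro ⟨h1, h2⟩
      exact ⟨⟨h1.1.le, h1.2.le⟩, (lg h1).2 h2⟩
  obtain ⟨p, hp⟩ := hS.exists_isLeast ⟨p0, hp0S⟩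
  obtain ⟨q, hq⟩ := hS.exists_isGreatest ⟨p0, hp0S⟩
  have hpq : p ≤ q := hp.2 hq.1
  have hSI : ∀ t, t ∈ S ↔ t ∈ Icc p q := fun t =>
    ⟨fun h => ⟨hp.2 h, hq.2 h⟩, fun h => hconv.ordConnected.out hp.1 hq.1 h⟩
  rcases hpq.eq_or_lt with hpq | hpq
  · left
    intro t ht
    by_cases hts : t ∈ S
    · have h1 := (hSI t).1 hts
      have h2 := (hSI p0).1 hp0S
      have : t = p0 := by linarith [h1.1, h1.2, h2.1, h2.2]
      rw [this, hz]
    · exact (hout t ht hts).le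
  · right
    refine ⟨by omega, hd, ?_⟩
    obtain ⟨α, β, hβ, k1, k2⟩ := chord h hm hc (hSo hp.1) (hSo hq.1) hpq
    refine ⟨α, β, hβ, fun t ht => ?_⟩
    by_cases hts : t ∈ S
    · exact mul_nonneg (by linarith [k1 t ht ((hSI t).1 hts)]) (hin t ht hts)
    · exact mul_nonneg_of_nonpos_of_nonpos
        (by linarith [k2 t ht (fun h => hts ((hSI t).2 h))]) (hout t ht hts).le

lemma core (h : ℝ → ℝ) (hm : MonotoneOn h (Ioo 0 1))
    (hc : ConcaveOn ℝ (Ioi 0) (fun z => h (z / (1 + z))))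
    (a b c d : ℕ) (hac : c ≤ a) (hcond : (c + 1) * b ≤ (a + 1) * d)
    (i1 : IntegrableOn (fun t => Wt a b t / It a b * h t) (Ioo 0 1))
    (i2 : IntegrableOn (fun t => Wt c d t / It c d * h t) (Ioo 0 1)) :
    ∫ t in Ioo (0:ℝ) 1, Wt c d t / It c d * h t ≤
      ∫ t in Ioo (0:ℝ) 1, Wt a b t / It a b * h t := by
  have B1 := It_pos a b
  have B2 := It_pos c d
  have j1 : IntegrableOn (fun t => Wt a b t / It a b) (Ioo 0 1) := (Wt_int a b).div_const _
  have j2 : IntegrableOn (fun t => Wt c d t / It c d) (Ioo 0 1) := (Wt_int c d).div_const _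
  have n1 : ∫ t in Ioo (0:ℝ) 1, Wt a b t / It a b = 1 := by
    rw [integral_div]; exact div_self B1.ne'
  have n2 : ∫ t in Ioo (0:ℝ) 1, Wt c d t / It c d = 1 := by
    rw [integral_div]; exact div_self B2.ne'
  obtain ⟨D, hD⟩ : ∃ D : ℝ → ℝ, D = fun t => Wt a b t / It a b - Wt c d t / It c d := ⟨_, rfl⟩
  have jD : IntegrableOn D (Ioo 0 1) := by rw [hD]; exact j1.sub j2
  have h0 : ∫ t in Ioo (0:ℝ) 1, D t = 0 := by
    rw [hD, integral_sub j1 j2, n1, n2, sub_self]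
  have iD : IntegrableOn (fun t => h t * D t) (Ioo 0 1) := by
    refine (i1.sub i2).congr (ae_of_all _ fun t => ?_)
    simp only [hD, Pi.sub_apply]; ring
  have eD : ∫ t in Ioo (0:ℝ) 1, h t * D t = (∫ t in Ioo (0:ℝ) 1, Wt a b t / It a b * h t) -
      ∫ t in Ioo (0:ℝ) 1, Wt c d t / It c d * h t := by
    rw [← integral_sub i1 i2]
    congr 1; ext t; rw [hD]; ring
  rw [← sub_nonneg, ← eD]
  rcases signs h hm hc a b c d hac hcond D hD h0 with ⟨κ, hκ⟩ | hneg | ⟨hb, hd, α, β, hβ, hs⟩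
  · have := setIntegral_nonneg (μ := volume) measurableSet_Ioo hκ
    have e : ∫ t in Ioo (0:ℝ) 1, (h t - κ) * D t = ∫ t in Ioo (0:ℝ) 1, h t * D t := by
      have : ∀ t, (h t - κ) * D t = h t * D t - κ * D t := fun t => by ring
      simp only [this]
      rw [integral_sub iD (jD.const_mul κ), integral_const_mul, h0]; simp
    linarith
  · have hz : (fun t => - D t) =ᵐ[volume.restrict (Ioo (0:ℝ) 1)] 0 := by
      have jN : IntegrableOn (fun t => - D t) (Ioo 0 1) := jD.neg
      rw [← setIntegral_eq_zero_iff_of_nonneg_ae _ jN]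
      · rw [integral_neg, h0, neg_zero]
      · filter_upwards [ae_restrict_mem measurableSet_Ioo] with t ht
        simpa using hneg t ht
    have : ∫ t in Ioo (0:ℝ) 1, h t * D t = ∫ t in Ioo (0:ℝ) 1, (0:ℝ) := by
      apply integral_congr_ae
      filter_upwards [hz] with t ht
      have : D t = 0 := by simpa using ht
      simp [this]
    rw [this]; simp
  · have := setIntegral_nonneg (μ := volume) measurableSet_Ioo hs
    obtain ⟨b, rfl⟩ := Nat.exists_eq_succ_of_ne_zero hb.ne'
    obtain ⟨d, rfl⟩ := Nat.exists_eq_succ_of_ne_zero hd.ne'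
    simp only [Nat.succ_eq_add_one] at *
    have k1 : IntegrableOn (fun t => Wt (a+1) b t / It a (b+1)) (Ioo 0 1) :=
      (Wt_int _ _).div_const _
    have k2 : IntegrableOn (fun t => Wt (c+1) d t / It c (d+1)) (Ioo 0 1) :=
      (Wt_int _ _).div_const _
    have e : ∫ t in Ioo (0:ℝ) 1, (h t - (α + β * (t / (1 - t)))) * D t =
        ∫ t in Ioo (0:ℝ) 1, ((h t * D t - α * D t) -
          β * (Wt (a+1) b t / It a (b+1) - Wt (c+1) d t / It c (d+1))) := by
      apply setIntegral_congr_fun measurableSet_Ioo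
      intro t ht
      have t1 : 1 - t ≠ 0 := by linarith [ht.2]
      simp only [hD, Wt]
      field_simp
      ring
    have q1 : IntegrableOn (fun t => h t * D t - α * D t) (Ioo 0 1) := iD.sub (jD.const_mul α)
    have q2 : IntegrableOn (fun t => β * (Wt (a+1) b t / It a (b+1) -
        Wt (c+1) d t / It c (d+1))) (Ioo 0 1) := (k1.sub k2).const_mul β
    rw [e, integral_sub q1 q2,
      integral_sub iD (jD.const_mul α), integral_const_mul, integral_const_mul, h0,
      integral_sub k1 k2, integral_div, integral_div] at this
    have r1 := It_rec a b
    have r2 := It_rec c d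
    have m1 : (∫ t in Ioo (0:ℝ) 1, Wt (a+1) b t) / It a (b+1) = ((a:ℝ)+1) / (b+1) := by
      change It (a+1) b / _ = _
      rw [div_eq_div_iff B1.ne' (by positivity)]; linarith
    have m2 : (∫ t in Ioo (0:ℝ) 1, Wt (c+1) d t) / It c (d+1) = ((c:ℝ)+1) / (d+1) := by
      change It (c+1) d / _ = _
      rw [div_eq_div_iff B2.ne' (by positivity)]; linarith
    rw [m1, m2] at this
    have hcr : ((c:ℝ)+1) / (d+1) ≤ ((a:ℝ)+1) / (b+1) := by
      rw [div_le_div_iff₀ (by positivity) (by positivity)]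
      exact_mod_cast hcond
    have := mul_nonneg hβ (sub_nonneg.2 hcr)
    linarith

lemma beta_red (i n : ℕ) (hi : 1 ≤ i) (hin : i ≤ n) :
    betaLaw i n = (volume.restrict (Set.Ioo (0:ℝ) 1)).withDensity fun t =>
      ENNReal.ofReal (Wt (i-1) (n-i) t / It (i-1) (n-i)) := by
  have e : ∀ t : ℝ, t ^ ((i:ℝ) - 1) * (1 - t) ^ ((n:ℝ) - (i:ℝ)) = Wt (i-1) (n-i) t := by
    intro t
    have h1 : ((i:ℝ) - 1) = ((i-1 : ℕ) : ℝ) := by push_cast [hi]; ring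
    have h2 : ((n:ℝ) - i) = ((n-i : ℕ) : ℝ) := by push_cast [hin]; ring
    rw [h1, h2, Real.rpow_natCast, Real.rpow_natCast]; rfl
  have eB : Bfun (i:ℝ) ((n:ℝ) - (i:ℝ) + 1) = It (i-1) (n-i) := by
    unfold Bfun It
    simp only [add_sub_cancel_right, e]
  unfold betaLaw
  simp only [e, eB]

lemma os_red (F : ℝ → ℝ) (hq : MonotoneOn (qf F) (Ioo 0 1)) (i n : ℕ) (hi : 1 ≤ i) (hin : i ≤ n)
    (u : ℝ → ℝ) (hu : Monotone u) (hint : Integrable u (osLaw F i n)) :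
    IntegrableOn (fun t => Wt (i-1) (n-i) t / It (i-1) (n-i) * u (qf F t)) (Ioo 0 1) ∧
    ∫ x, u x ∂(osLaw F i n) =
      ∫ t in Ioo (0:ℝ) 1, Wt (i-1) (n-i) t / It (i-1) (n-i) * u (qf F t) := by
  have B := It_pos (i-1) (n-i)
  have hmeas : Measurable fun t => ENNReal.ofReal (Wt (i-1) (n-i) t / It (i-1) (n-i)) :=
    (((Wt_cont _ _).div_const _).measurable).ennreal_ofReal
  have hqm : AEMeasurable (qf F) (betaLaw i n) := by
    rw [beta_red i n hi hin]
    exact (aemeasurable_restrict_of_monotoneOn measurableSet_Ioo hq).mono_ac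
      (withDensity_absolutelyContinuous _ _)
  have hae : (fun t => (ENNReal.ofReal (Wt (i-1) (n-i) t / It (i-1) (n-i))).toReal • u (qf F t))
      =ᵐ[volume.restrict (Ioo (0:ℝ) 1)]
      fun t => Wt (i-1) (n-i) t / It (i-1) (n-i) * u (qf F t) := by
    filter_upwards [ae_restrict_mem measurableSet_Ioo] with t ht
    rw [ENNReal.toReal_ofReal (div_nonneg (Wt_pos _ _ ht).le B.le), smul_eq_mul]
  unfold osLaw at hint ⊢
  constructor
  · rw [integrable_map_measure hu.measurable.aestronglyMeasurable hqm, beta_red i n hi hin,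
      integrable_withDensity_iff_integrable_smul₀' hmeas.aemeasurable
        (ae_of_all _ fun _ => ENNReal.ofReal_lt_top)] at hint
    exact hint.congr hae
  · rw [integral_map hqm hu.measurable.aestronglyMeasurable, beta_red i n hi hin,
      integral_withDensity_eq_integral_toReal_smul₀ hmeas.aemeasurable
        (ae_of_all _ fun _ => ENNReal.ofReal_lt_top)]
    exact integral_congr_ae hae

/-- If `F` is IOR (the odds `F/(1-F)` convex on `{F < 1}`) and `i/n ≥ j/m`
with `i ≥ j`, then `X_{i:n} ≥_icv X_{j:m}`. -/
theorem stmt3 (F : ℝ → ℝ) (hF : IsCDF F)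
    (i n j m : ℕ) (hj1 : 1 ≤ j) (hjm : j ≤ m) (hi1 : 1 ≤ i) (hin : i ≤ n) (hij : j ≤ i)
    (hIOR : ConvexOn ℝ {x : ℝ | F x < 1} (fun x => F x / (1 - F x)))
    (hcond : (j:ℝ) / (m:ℝ) ≤ (i:ℝ) / (n:ℝ)) :
    icvLE (osLaw F i n) (osLaw F j m) := by
  obtain ⟨hmono, -, hbot, htop⟩ := hF
  obtain ⟨q1, q2⟩ := concave_qf F hmono hbot htop hIOR
  intro u hu huc hi hj
  obtain ⟨i1, e1⟩ := os_red F q1 i n hi1 hin u hu hi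
  obtain ⟨i2, e2⟩ := os_red F q1 j m hj1 hjm u hu hj
  rw [e1, e2]
  refine core (fun t => u (qf F t)) (fun x hx y hy hxy => hu (q1 hx hy hxy)) ?_ (i-1) (n-i) (j-1)
    (m-j) (by omega) ?_ i1 i2
  · refine ⟨convex_Ioi 0, fun x hx y hy s t hs ht hst => ?_⟩
    exact (huc.2 (mem_univ _) (mem_univ _) hs ht hst).trans (hu (q2.2 hx hy hs ht hst))
  · rw [div_le_div_iff₀ (by exact_mod_cast (by omega : 0 < m))
      (by exact_mod_cast (by omega : 0 < n))] at hcond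
    have hc : j * n ≤ i * m := by exact_mod_cast hcond
    rw [Nat.sub_add_cancel hi1, Nat.sub_add_cancel hj1, Nat.mul_sub, Nat.mul_sub, mul_comm i j]
    exact Nat.sub_le_sub_right hc _
end

section
/- Let X be a random variable with CDF F, and let 1 ≤ i ≤ n and 1 ≤ j ≤ m with i ≤ j. If F is DD (i.e. F^{-1} is convex on (0,1)) and i/(n+1) ≥ j/(m+1), then X_{i:n} ≥_icx X_{j:m}. -/
open MeasureTheory Set Filter

noncomputable def wt (p q : ℕ) (t : ℝ) : ℝ := t ^ p * (1 - t) ^ q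

lemma wt_cont (p q : ℕ) : Continuous (wt p q) := by unfold wt; fun_prop

lemma wt_pos (p q : ℕ) {t : ℝ} (ht : t ∈ Ioo (0:ℝ) 1) : 0 < wt p q t := by
  have h1 := ht.1
  have h2 : 0 < 1 - t := by linarith [ht.2]
  unfold wt; positivity

lemma cont_int {f : ℝ → ℝ} (hf : Continuous f) : IntegrableOn f (Ioo (0:ℝ) 1) :=
  (hf.integrableOn_Icc (a := 0) (b := 1)).mono_set Ioo_subset_Icc_self

lemma wt_int_pos (p q : ℕ) : 0 < ∫ t in Ioo (0:ℝ) 1, wt p q t := by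
  rw [← integral_Ioc_eq_integral_Ioo, ← intervalIntegral.integral_of_le zero_le_one]
  exact intervalIntegral.intervalIntegral_pos_of_pos_on ((wt_cont p q).intervalIntegrable _ _)
    (fun x hx => wt_pos p q hx) zero_lt_one

lemma wt_mean (p q : ℕ) : ((p:ℝ) + 1) * (∫ t in Ioo (0:ℝ) 1, wt p q t) =
    ((p:ℝ) + q + 2) * ∫ t in Ioo (0:ℝ) 1, t * wt p q t := by
  have hd : ∀ t ∈ uIcc (0:ℝ) 1, HasDerivAt (fun t : ℝ => t ^ (p+1) * (1 - t) ^ (q+1))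
      (((p:ℝ) + 1) * wt p q t - ((p:ℝ) + q + 2) * (t * wt p q t)) t := by
    intro t _
    have h := (hasDerivAt_pow (p+1) t).mul (((hasDerivAt_id t).const_sub 1).pow (q+1))
    refine h.congr_deriv ?_
    simp only [wt, id, Nat.add_sub_cancel, Pi.pow_apply]
    push_cast
    ring
  have hc1 := wt_cont p q
  have h := intervalIntegral.integral_eq_sub_of_hasDerivAt hd
    (Continuous.intervalIntegrable (by fun_prop) _ _)
  rw [intervalIntegral.integral_sub (Continuous.intervalIntegrable (by fun_prop) _ _)
    (Continuous.intervalIntegrable (by fun_prop) _ _), intervalIntegral.integral_const_mul,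
    intervalIntegral.integral_const_mul, intervalIntegral.integral_of_le zero_le_one,
    intervalIntegral.integral_of_le zero_le_one, integral_Ioc_eq_integral_Ioo,
    integral_Ioc_eq_integral_Ioo] at h
  simp at h
  linarith

lemma secant_sign {g : ℝ → ℝ} (hm : MonotoneOn g (Ioo 0 1)) (hc : ConvexOn ℝ (Ioo 0 1) g)
    {p q : ℝ} (hp : 0 < p) (hpq : p < q) (hq : q < 1) :
    ∃ s c : ℝ, 0 ≤ s ∧ ∀ t ∈ Ioo (0:ℝ) 1,
      (p ≤ t → t ≤ q → g t - (s * t + c) ≤ 0) ∧ (t ≤ p ∨ q ≤ t → 0 ≤ g t - (s * t + c)) := by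
  have hpm : p ∈ Ioo (0:ℝ) 1 := ⟨hp, by linarith⟩
  have hqm : q ∈ Ioo (0:ℝ) 1 := ⟨by linarith, hq⟩
  have hd : 0 < q - p := by linarith
  obtain ⟨s, hs⟩ : ∃ s, s = (g q - g p) / (q - p) := ⟨_, rfl⟩
  have hs' : s * (q - p) = g q - g p := by rw [hs]; field_simp
  refine ⟨s, g p - s * p, ?_, ?_⟩
  · rw [hs]; exact div_nonneg (by linarith [hm hpm hqm hpq.le]) hd.le
  intro t ht
  constructor
  · intro h1 h2
    rcases h1.eq_or_lt with rfl | h1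
    · linarith
    rcases h2.eq_or_lt with rfl | h2
    · nlinarith
    have := hc.secant_mono_aux1 hpm hqm h1 h2
    have : (q - p) * (g t - (s * t + (g p - s * p))) ≤ 0 := by
      have e : g q = g p + s * (q - p) := by linarith
      rw [e] at this
      nlinarith
    by_contra hcon
    push Not at hcon
    nlinarith
  · intro h
    have key : 0 ≤ (q - p) * (g t - (s * t + (g p - s * p))) := by
      have e : g q = g p + s * (q - p) := by linarith
      rcases h with h | h
      · rcases h.eq_or_lt with rfl | h
        · nlinarith
        have := hc.secant_mono_aux1 ht hqm h hpq
        rw [e] at this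
        nlinarith
      · rcases h.eq_or_lt with rfl | h
        · nlinarith
        have := hc.secant_mono_aux1 hpm ht hpq h
        rw [e] at this
        nlinarith
    by_contra hcon
    push Not at hcon
    nlinarith

lemma ratio_iff {p q a b : ℕ} {A B t : ℝ} (hA : 0 < A) (hB : 0 < B) (ht : t ∈ Ioo (0:ℝ) 1) :
    wt p q t / A < wt (p + a) (q + b) t / B ↔ B < A * (t ^ a * (1 - t) ^ b) := by
  have hw := wt_pos p q ht
  have e : wt (p + a) (q + b) t = wt p q t * (t ^ a * (1 - t) ^ b) := by
    unfold wt; ring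
  rw [e, div_lt_div_iff₀ hA hB, mul_assoc, mul_lt_mul_iff_right₀ hw, mul_comm A]

lemma S_convex (a b : ℕ) {A B : ℝ} (hA : 0 < A) (hB : 0 < B) :
    Convex ℝ {t | t ∈ Ioo (0:ℝ) 1 ∧ B < A * (t ^ a * (1 - t) ^ b)} := by
  have h1 : ConcaveOn ℝ (Ioo (0:ℝ) 1) Real.log :=
    strictConcaveOn_log_Ioi.concaveOn.subset Ioo_subset_Ioi_self (convex_Ioo _ _)
  have h2 : ConcaveOn ℝ (Ioo (0:ℝ) 1) (fun t => Real.log (1 - t)) := by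
    refine ⟨convex_Ioo _ _, fun x hx y hy u v hu hv huv => ?_⟩
    have := h1.2 (x := 1 - x) (y := 1 - y) ⟨by linarith [hx.2], by linarith [hx.1]⟩
      ⟨by linarith [hy.2], by linarith [hy.1]⟩ hu hv huv
    convert this using 2
    simp only [smul_eq_mul]
    linear_combination -huv
  have h3 := ((h1.smul (Nat.cast_nonneg (α := ℝ) a)).add (h2.smul (Nat.cast_nonneg (α := ℝ) b))).convex_gt
    (Real.log (B / A))
  refine (congrArg (Convex ℝ) (Set.ext fun t => ?_)).mpr h3
  refine and_congr_right fun ht => ?_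
  simp only [Pi.add_apply, smul_eq_mul]
  have ha : 0 < t := ht.1
  have hb : 0 < 1 - t := by linarith [ht.2]
  rw [← Real.log_pow, ← Real.log_pow, ← Real.log_mul (by positivity) (by positivity),
    Real.log_lt_log_iff (by positivity) (by positivity), div_lt_iff₀ hA, mul_comm A]

lemma sign_exists {g : ℝ → ℝ} (hm : MonotoneOn g (Ioo 0 1)) (hc : ConvexOn ℝ (Ioo 0 1) g)
    (a b : ℕ) {A B : ℝ} (hA : 0 < A) (hB : 0 < B) (hb : b ≠ 0)
    (hne : {t | t ∈ Ioo (0:ℝ) 1 ∧ B < A * (t ^ a * (1 - t) ^ b)}.Nonempty) :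
    ∃ s c : ℝ, 0 ≤ s ∧ ∀ t ∈ Ioo (0:ℝ) 1,
      (B < A * (t ^ a * (1 - t) ^ b) → g t - (s * t + c) ≤ 0) ∧
      (¬ B < A * (t ^ a * (1 - t) ^ b) → 0 ≤ g t - (s * t + c)) := by
  have hconv := S_convex a b hA hB
  set S := {t | t ∈ Ioo (0:ℝ) 1 ∧ B < A * (t ^ a * (1 - t) ^ b)} with hS
  have hopen : IsOpen S := isOpen_Ioo.inter
    (isOpen_lt continuous_const (by fun_prop) : IsOpen {t : ℝ | B < A * (t ^ a * (1 - t) ^ b)})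
  have hbb : BddBelow S := ⟨0, fun t ht => ht.1.1.le⟩
  have hba : BddAbove S := ⟨1, fun t ht => ht.1.2.le⟩
  have hr : 0 < B / A := div_pos hB hA
  obtain ⟨t0, ht0⟩ := hne
  have hq : sSup S < 1 := by
    have : sSup S ≤ 1 - B / A := by
      refine csSup_le ⟨t0, ht0⟩ fun t ht => ?_
      have h0 : 0 ≤ t := ht.1.1.le
      have h1 : 0 ≤ 1 - t := by linarith [ht.1.2]
      have e1 : t ^ a ≤ 1 := pow_le_one₀ h0 ht.1.2.le
      have e2 : (1 - t) ^ b ≤ 1 - t := pow_le_of_le_one h1 (by linarith) hb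
      have e3 : t ^ a * (1 - t) ^ b ≤ 1 - t := by
        nlinarith [pow_nonneg h0 a, pow_nonneg h1 b]
      have : B / A < t ^ a * (1 - t) ^ b := by rw [div_lt_iff₀ hA, mul_comm]; exact ht.2
      linarith
    linarith
  have htq : t0 ≤ sSup S := le_csSup hba ht0
  have hpt : sInf S ≤ t0 := csInf_le hbb ht0
  rcases eq_or_ne a 0 with rfl | ha
  · refine ⟨0, g (sSup S), le_rfl, fun t ht => ?_⟩
    have hqm : sSup S ∈ Ioo (0:ℝ) 1 := ⟨ht0.1.1.trans_le htq, hq⟩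
    constructor
    · intro h
      have := hm ht hqm (le_csSup hba ⟨ht, h⟩)
      linarith
    · intro h
      have : sSup S ≤ t := by
        by_contra hcon
        push Not at hcon
        obtain ⟨x, hx, hxt⟩ := exists_lt_of_lt_csSup ⟨t0, ht0⟩ hcon
        apply h
        refine hx.2.trans_le ?_
        have : (1 - x) ^ b ≤ (1 - t) ^ b := pow_le_pow_left₀ (by linarith [hx.1.2]) (by linarith) b
        simp only [pow_zero, one_mul]
        nlinarith
      linarith [hm hqm ht this]
  · have hp : 0 < sInf S := by
      have : B / A ≤ sInf S := by
        refine le_csInf ⟨t0, ht0⟩ fun t ht => ?_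
        have h0 : 0 ≤ t := ht.1.1.le
        have h1 : 0 ≤ 1 - t := by linarith [ht.1.2]
        have e1 : t ^ a ≤ t := pow_le_of_le_one h0 ht.1.2.le ha
        have e2 : (1 - t) ^ b ≤ 1 := pow_le_one₀ h1 (by linarith)
        have e3 : t ^ a * (1 - t) ^ b ≤ t := by
          nlinarith [pow_nonneg h0 a, pow_nonneg h1 b]
        have : B / A < t ^ a * (1 - t) ^ b := by rw [div_lt_iff₀ hA, mul_comm]; exact ht.2
        linarith
      linarith
    have hlt : sInf S < sSup S := by
      obtain ⟨e, he, hsub⟩ := Metric.isOpen_iff.1 hopen t0 ht0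
      have : t0 + e / 2 ∈ S := hsub (by
        rw [Metric.mem_ball, Real.dist_eq, show t0 + e / 2 - t0 = e / 2 by ring,
          abs_of_pos (by linarith)]
        linarith)
      have := le_csSup hba this
      linarith
    obtain ⟨s, c, hs, h⟩ := secant_sign hm hc hp hlt hq
    refine ⟨s, c, hs, fun t ht => ⟨fun h1 => ?_, fun h1 => ?_⟩⟩
    · exact (h t ht).1 (csInf_le hbb ⟨ht, h1⟩) (le_csSup hba ⟨ht, h1⟩)
    · refine (h t ht).2 ?_
      by_contra hcon
      push Not at hcon
      obtain ⟨x, hx, hxt⟩ := exists_lt_of_csInf_lt ⟨t0, ht0⟩ hcon.1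
      obtain ⟨y, hy, hty⟩ := exists_lt_of_lt_csSup ⟨t0, ht0⟩ hcon.2
      exact h1 (hconv.ordConnected.out hx hy ⟨hxt.le, hty.le⟩).2

lemma core_s5 {g : ℝ → ℝ} (hm : MonotoneOn g (Ioo 0 1)) (hc : ConvexOn ℝ (Ioo 0 1) g)
    (p q a b : ℕ) (hcond : ((p:ℝ) + a + 1) * (q + 1) ≤ ((p:ℝ) + 1) * (q + b + 1))
    {A B : ℝ} (hA : A = ∫ t in Ioo (0:ℝ) 1, wt p q t)
    (hB : B = ∫ t in Ioo (0:ℝ) 1, wt (p + a) (q + b) t)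
    (h1 : IntegrableOn (fun t => wt p q t / A * g t) (Ioo 0 1))
    (h2 : IntegrableOn (fun t => wt (p + a) (q + b) t / B * g t) (Ioo 0 1)) :
    ∫ t in Ioo (0:ℝ) 1, wt (p + a) (q + b) t / B * g t ≤
      ∫ t in Ioo (0:ℝ) 1, wt p q t / A * g t := by
  have hA0 : 0 < A := hA ▸ wt_int_pos p q
  have hB0 : 0 < B := hB ▸ wt_int_pos _ _
  have c1 := wt_cont p q
  have c2 := wt_cont (p + a) (q + b)
  set h : ℝ → ℝ := fun t => wt p q t / A - wt (p + a) (q + b) t / B with hh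
  have hcont : Continuous h := by fun_prop
  have hint0 : ∫ t in Ioo (0:ℝ) 1, h t = 0 := by
    rw [hh, integral_sub (cont_int (by fun_prop)) (cont_int (by fun_prop)), integral_div,
      integral_div, ← hA, ← hB, div_self hA0.ne', div_self hB0.ne', sub_self]
  have hint1 : 0 ≤ ∫ t in Ioo (0:ℝ) 1, t * h t := by
    have e : (fun t => t * h t) = fun t => t * wt p q t / A - t * wt (p + a) (q + b) t / B := by
      ext t; simp only [hh]; ring
    rw [e, integral_sub (cont_int (by fun_prop)) (cont_int (by fun_prop)), integral_div,
      integral_div]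
    have m1 := wt_mean p q
    have m2 := wt_mean (p + a) (q + b)
    rw [← hA] at m1
    rw [← hB] at m2
    push_cast at m2
    have f1 : (∫ t in Ioo (0:ℝ) 1, t * wt p q t) / A = ((p:ℝ) + 1) / (p + q + 2) := by
      rw [div_eq_div_iff hA0.ne' (by positivity)]; linarith
    have f2 : (∫ t in Ioo (0:ℝ) 1, t * wt (p + a) (q + b) t) / B
        = ((p:ℝ) + a + 1) / (p + a + (q + b) + 2) := by
      rw [div_eq_div_iff hB0.ne' (by positivity)]; linarith
    rw [f1, f2, sub_nonneg, div_le_div_iff₀ (by positivity) (by positivity)]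
    nlinarith
  have hgh : IntegrableOn (fun t => h t * g t) (Ioo 0 1) := by
    refine (h1.sub h2).congr (Eventually.of_forall fun t => ?_)
    simp only [hh, Pi.sub_apply]; ring
  suffices H : 0 ≤ ∫ t in Ioo (0:ℝ) 1, h t * g t by
    rw [← sub_nonneg, ← integral_sub h1 h2]
    convert H using 3
    simp only [hh]; ring
  by_cases hne : {t | t ∈ Ioo (0:ℝ) 1 ∧ B < A * (t ^ a * (1 - t) ^ b)}.Nonempty
  · have hb : b ≠ 0 := by
      rintro rfl
      have ha : a = 0 := by
        by_contra ha
        have : (0:ℝ) < a := by positivity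
        push_cast at hcond
        have hq0 : (0:ℝ) ≤ q := by positivity
        nlinarith
      subst ha
      obtain ⟨t, _, ht⟩ := hne
      simp only [add_zero] at hB
      rw [← hA] at hB
      simp [hB] at ht
    obtain ⟨s, c, hs, hsc⟩ := sign_exists hm hc a b hA0 hB0 hb hne
    have hpt : ∀ t ∈ Ioo (0:ℝ) 1, s * (t * h t) + c * h t ≤ h t * g t := by
      intro t ht
      have hr := ratio_iff (p := p) (q := q) (a := a) (b := b) hA0 hB0 ht
      by_cases hS : B < A * (t ^ a * (1 - t) ^ b)
      · have x1 := (hsc t ht).1 hS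
        have x2 : h t ≤ 0 := by simp only [hh]; linarith [hr.2 hS]
        nlinarith
      · have x1 := (hsc t ht).2 hS
        have x2 : 0 ≤ h t := by simp only [hh]; linarith [not_lt.1 (fun z => hS (hr.1 z))]
        nlinarith
    have i1 : IntegrableOn (fun t => s * (t * h t)) (Ioo 0 1) := cont_int (by fun_prop)
    have i2 : IntegrableOn (fun t => c * h t) (Ioo 0 1) := cont_int (by fun_prop)
    have := setIntegral_mono_on (i1.add i2) hgh measurableSet_Ioo hpt
    refine le_trans ?_ this
    simp only [Pi.add_apply]
    rw [integral_add i1 i2, integral_const_mul, integral_const_mul, hint0]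
    simp only [mul_zero, add_zero]
    exact mul_nonneg hs hint1
  · have hn : ∀ t ∈ Ioo (0:ℝ) 1, 0 ≤ h t := by
      intro t ht
      have hr := ratio_iff (p := p) (q := q) (a := a) (b := b) hA0 hB0 ht
      have : ¬ B < A * (t ^ a * (1 - t) ^ b) := fun z => hne ⟨t, ht, z⟩
      simp only [hh]; linarith [not_lt.1 (fun z => this (hr.1 z))]
    have hz := (setIntegral_eq_zero_iff_of_nonneg_ae
      (ae_restrict_of_forall_mem measurableSet_Ioo hn) (cont_int hcont)).1 hint0
    rw [integral_eq_zero_of_ae]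
    filter_upwards [hz] with t ht
    simp [ht]

lemma qf_mono {F : ℝ → ℝ} (hF : IsCDF F) : MonotoneOn (qf F) (Ioo 0 1) := by
  obtain ⟨hm, -, h0, h1⟩ := hF
  intro x hx y hy hxy
  refine csInf_le_csInf ?_ ?_ (fun z hz => hxy.trans hz)
  · obtain ⟨z, hz⟩ := (h0.eventually (gt_mem_nhds hx.1)).exists
    refine ⟨z, fun w hw => ?_⟩
    by_contra hcon
    push Not at hcon
    have := hm hcon.le
    have hw' : x ≤ F w := hw
    linarith
  · obtain ⟨z, hz⟩ := (h1.eventually (lt_mem_nhds hy.2)).exists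
    exact ⟨z, hz.le⟩

lemma betaLaw_eq {i n : ℕ} (hi : 1 ≤ i) (hin : i ≤ n) :
    betaLaw i n = (volume.restrict (Ioo (0:ℝ) 1)).withDensity fun t =>
      ENNReal.ofReal (wt (i - 1) (n - i) t / ∫ t in Ioo (0:ℝ) 1, wt (i - 1) (n - i) t) := by
  have e1 : (i:ℝ) - 1 = ((i - 1 : ℕ) : ℝ) := by push_cast [hi]; ring
  have e2 : (n:ℝ) - i = ((n - i : ℕ) : ℝ) := by push_cast [hin]; ring
  unfold betaLaw Bfun wt
  simp only [add_sub_cancel_right, e1, e2, Real.rpow_natCast]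

lemma os_int {F : ℝ → ℝ} (hF : IsCDF F) {i n : ℕ} (hi : 1 ≤ i) (hin : i ≤ n) {u : ℝ → ℝ}
    (hu : Monotone u) :
    (Integrable u (osLaw F i n) → IntegrableOn (fun t => wt (i - 1) (n - i) t /
      (∫ t in Ioo (0:ℝ) 1, wt (i - 1) (n - i) t) * u (qf F t)) (Ioo 0 1)) ∧
    ∫ x, u x ∂(osLaw F i n) = ∫ t in Ioo (0:ℝ) 1, wt (i - 1) (n - i) t /
      (∫ t in Ioo (0:ℝ) 1, wt (i - 1) (n - i) t) * u (qf F t) := by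
  unfold osLaw
  rw [betaLaw_eq hi hin]
  have hq : AEMeasurable (qf F) (volume.restrict (Ioo (0:ℝ) 1)) :=
    aemeasurable_restrict_of_monotoneOn measurableSet_Ioo (qf_mono hF)
  obtain ⟨A, hA⟩ : ∃ A, A = ∫ t in Ioo (0:ℝ) 1, wt (i - 1) (n - i) t := ⟨_, rfl⟩
  have hA0 : 0 < A := hA ▸ wt_int_pos _ _
  rw [← hA]
  have hc := wt_cont (i - 1) (n - i)
  have hmeas : Measurable fun t => ENNReal.ofReal (wt (i - 1) (n - i) t / A) :=
    (Continuous.measurable (by fun_prop)).ennreal_ofReal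
  have hq' := hq.mono_ac (withDensity_absolutelyContinuous (volume.restrict (Ioo (0:ℝ) 1))
    (fun t => ENNReal.ofReal (wt (i - 1) (n - i) t / A)))
  have hfin : ∀ᵐ t ∂(volume.restrict (Ioo (0:ℝ) 1)),
      ENNReal.ofReal (wt (i - 1) (n - i) t / A) < ⊤ :=
    Eventually.of_forall fun t => ENNReal.ofReal_lt_top
  have hre : ∀ t ∈ Ioo (0:ℝ) 1, (ENNReal.ofReal (wt (i - 1) (n - i) t / A)).toReal
      = wt (i - 1) (n - i) t / A := fun t ht =>
    ENNReal.toReal_ofReal (div_nonneg (wt_pos _ _ ht).le hA0.le)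
  constructor
  · intro h
    have h := (integrable_map_measure hu.measurable.aestronglyMeasurable hq').1 h
    rw [integrable_withDensity_iff_integrable_smul₀' hmeas.aemeasurable hfin] at h
    refine IntegrableOn.congr_fun h (fun t ht => ?_) measurableSet_Ioo
    simp only [hre t ht, smul_eq_mul, Function.comp]
  · rw [integral_map hq' hu.measurable.aestronglyMeasurable,
      integral_withDensity_eq_integral_toReal_smul₀ hmeas.aemeasurable hfin]
    refine setIntegral_congr_fun measurableSet_Ioo fun t ht => ?_
    simp only [hre t ht, smul_eq_mul]

/-- If `F` is DD (`F⁻¹` convex on `(0,1)`) and `i/(n+1) ≥ j/(m+1)` with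
`i ≤ j`, then `X_{i:n} ≥_icx X_{j:m}`. -/
theorem stmt5 (F : ℝ → ℝ) (hF : IsCDF F)
    (i n j m : ℕ) (hi1 : 1 ≤ i) (hin : i ≤ n) (hj1 : 1 ≤ j) (hjm : j ≤ m) (hij : i ≤ j)
    (hDD : ConvexOn ℝ (Set.Ioo (0:ℝ) 1) (qf F))
    (hcond : (j:ℝ) / ((m:ℝ) + 1) ≤ (i:ℝ) / ((n:ℝ) + 1)) :
    icxLE (osLaw F i n) (osLaw F j m) := by
  intro u hu huc h1 h2
  obtain ⟨g1, e1⟩ := os_int hF hi1 hin hu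
  obtain ⟨g2, e2⟩ := os_int hF hj1 hjm hu
  have g1 := g1 h1
  have g2 := g2 h2
  rw [e1, e2]
  have hm : MonotoneOn (fun t => u (qf F t)) (Ioo 0 1) :=
    fun x hx y hy hxy => hu (qf_mono hF hx hy hxy)
  have hc : ConvexOn ℝ (Ioo 0 1) (fun t => u (qf F t)) := by
    refine ⟨convex_Ioo _ _, fun x hx y hy a b ha hb hab => ?_⟩
    exact (hu (hDD.2 hx hy ha hb hab)).trans (huc.2 (mem_univ _) (mem_univ _) ha hb hab)
  rw [div_le_div_iff₀ (by positivity) (by positivity)] at hcond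
  have hcN : j * (n + 1) ≤ i * (m + 1) := by exact_mod_cast hcond
  have hb : n - i ≤ m - j := by
    obtain ⟨q, rfl⟩ := Nat.exists_eq_add_of_le hin
    obtain ⟨q', rfl⟩ := Nat.exists_eq_add_of_le hjm
    have : j * (q + 1) ≤ i * (q' + 1) := by nlinarith
    have : i * (q + 1) ≤ i * (q' + 1) := (Nat.mul_le_mul_right _ hij).trans this
    have := Nat.le_of_mul_le_mul_left this hi1
    omega
  obtain ⟨a, ha⟩ := Nat.exists_eq_add_of_le (show i - 1 ≤ j - 1 by omega)
  obtain ⟨b, hb⟩ := Nat.exists_eq_add_of_le hb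
  rw [ha, hb] at g2 ⊢
  refine core_s5 hm hc (i - 1) (n - i) a b ?_ rfl rfl g1 g2
  have x1 : ((i - 1 : ℕ) : ℝ) = i - 1 := by push_cast [hi1]; ring
  have x2 : ((n - i : ℕ) : ℝ) = n - i := by push_cast [hin]; ring
  have x3 : (a : ℝ) = j - i := by
    have : j = i + a := by omega
    rw [this]; push_cast; ring
  have x4 : (b : ℝ) = m - j - (n - i) := by
    have : m + i = n + j + b := by omega
    have : (m:ℝ) + i = n + j + b := by exact_mod_cast this
    linarith
  rw [x1, x2, x3, x4]
  nlinarith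
end
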